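/- arXiv:1805.00982 — 2 statements merged into one kernel-verified Lean document; each statement's English description precedes it below -/
import Mathlib

section
/- (Lemma 8, pointwise averaged form.) Assume each f_i is L-smooth (not necessarily convex). For any x ∈ E and any θ_1,…,θ_n ∈ E, with ᾱ = (1/n)·Σ_{j=1}^n ∇f_j(θ_j): (1/n)·Σ_{i=1}^n ‖∇f_i(x) − ∇f_i(θ_i) + ᾱ‖² ≤ 2‖∇f(x)‖² + (2L²/n)·Σ_{i=1}^n ‖x − θ_i‖². -/
/-- The sum of squared deviations from the mean is at most the sum of squared norms. -/
theorem sum_norm_sub_mean_sq_le {ι E : Type*} [Fintype ι] [NormedAddCommGroup E]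
    [InnerProductSpace ℝ E] (d : ι → E) (m : E)
    (hm : ∑ i, d i = (Fintype.card ι : ℝ) • m) :
    ∑ i, ‖d i - m‖ ^ 2 ≤ ∑ i, ‖d i‖ ^ 2 := by
  have hinner : ∑ i, inner ℝ (d i) m = (Fintype.card ι : ℝ) * ‖m‖ ^ 2 := by
    rw [← sum_inner, hm, real_inner_smul_left, real_inner_self_eq_norm_sq]
  have hexpand : ∑ i, ‖d i - m‖ ^ 2 =
      ∑ i, ‖d i‖ ^ 2 - (Fintype.card ι : ℝ) * ‖m‖ ^ 2 := by
    simp only [norm_sub_sq_real, Finset.sum_add_distrib, Finset.sum_sub_distrib,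
      ← Finset.mul_sum, hinner, Finset.sum_const, Finset.card_univ, nsmul_eq_mul]
    ring
  rw [hexpand]
  exact sub_le_self _ (by positivity)

/-- The inequality `‖a + b‖² ≤ 2 ‖a‖² + 2 ‖b‖²`. -/
theorem norm_add_sq_le_two_mul {E : Type*} [SeminormedAddCommGroup E] (a b : E) :
    ‖a + b‖ ^ 2 ≤ 2 * ‖a‖ ^ 2 + 2 * ‖b‖ ^ 2 := by
  have h := pow_le_pow_left₀ (norm_nonneg _) (norm_add_le a b) 2
  nlinarith [sq_nonneg (‖a‖ - ‖b‖)]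

/-- Lemma 8, pointwise averaged form (variance bound for the variance-reduced
gradient estimate, non-convex setting). -/
theorem kSVRG_variance_bound {E : Type*} [NormedAddCommGroup E]
    [InnerProductSpace ℝ E] [CompleteSpace E]
    (n : ℕ) (hn : 0 < n) (L : ℝ) (hL : 0 < L)
    (f : Fin n → E → ℝ) (g : Fin n → E → E)
    (hgrad : ∀ i x, HasGradientAt (f i) (g i x) x)
    (hsmooth : ∀ i x y, ‖g i x - g i y‖ ≤ L * ‖x - y‖)
    (F : E → ℝ) (hF : ∀ x, F x = (1 / (n : ℝ)) * ∑ i, f i x)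
    (G : E → E) (hG : ∀ x, G x = (1 / (n : ℝ)) • ∑ i, g i x)
    (θ : Fin n → E) (αbar : E) (hαbar : αbar = (1 / (n : ℝ)) • ∑ j, g j (θ j))
    (x : E) :
    (1 / (n : ℝ)) * ∑ i, ‖g i x - g i (θ i) + αbar‖ ^ 2 ≤
      2 * ‖G x‖ ^ 2 + (2 * L ^ 2 / (n : ℝ)) * ∑ i, ‖x - θ i‖ ^ 2 := by
  have hn' : (n : ℝ) ≠ 0 := by positivity
  have hmean : ∑ i, (g i x - g i (θ i)) = (Fintype.card (Fin n) : ℝ) • (G x - αbar) := by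
    rw [hG, hαbar, ← smul_sub, smul_smul, Fintype.card_fin, mul_one_div_cancel hn', one_smul,
      Finset.sum_sub_distrib]
  have hvar := sum_norm_sub_mean_sq_le _ _ hmean
  have hlip : ∑ i, ‖g i x - g i (θ i)‖ ^ 2 ≤ L ^ 2 * ∑ i, ‖x - θ i‖ ^ 2 := by
    rw [Finset.mul_sum]
    refine Finset.sum_le_sum fun i _ => ?_
    rw [← mul_pow]
    exact pow_le_pow_left₀ (norm_nonneg _) (hsmooth i x (θ i)) 2
  have hsplit : ∑ i, ‖g i x - g i (θ i) + αbar‖ ^ 2 ≤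
      2 * ∑ i, ‖g i x - g i (θ i) - (G x - αbar)‖ ^ 2 + n * (2 * ‖G x‖ ^ 2) := by
    calc ∑ i, ‖g i x - g i (θ i) + αbar‖ ^ 2
        ≤ ∑ i, (2 * ‖g i x - g i (θ i) - (G x - αbar)‖ ^ 2 + 2 * ‖G x‖ ^ 2) := by
          refine Finset.sum_le_sum fun i _ => ?_
          have h := norm_add_sq_le_two_mul (g i x - g i (θ i) - (G x - αbar)) (G x)
          rwa [sub_add, sub_sub_cancel_left, sub_neg_eq_add] at h
      _ = _ := by
          simp [Finset.sum_add_distrib, Finset.mul_sum]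
  calc (1 / (n : ℝ)) * ∑ i, ‖g i x - g i (θ i) + αbar‖ ^ 2
      ≤ (1 / (n : ℝ)) * (2 * (L ^ 2 * ∑ i, ‖x - θ i‖ ^ 2) + n * (2 * ‖G x‖ ^ 2)) := by
        gcongr
        linarith
    _ = _ := by
        field_simp
        ring
end

section
/- (Lemma 10: one-outer-loop Lyapunov decrease for non-convex k-SVRG-V2.) Let ℓ ≤ n, γ > 0, 0 < η, and assume 2L²η²ℓ² < 1; set b₁ = 1/(1 − 2L²η²ℓ²). Let c' ≥ 0 and set c = c'·(1 − ℓ/n + γηℓ + 4b₁η²L²ℓ²) + 2b₁η²L³ℓ and Γ = η − c'·η/γ − b₁η²L − 2b₁c'η²ℓ. With the non-convex inner-loop process below, x̃(ω) = (1/ℓ)·Σ_{t=0}^{ℓ−1} x_t(ω), and θ_i^{new}(ω,Φ) = x̃(ω) if i ∈ Φ and θ_i otherwise (Φ a uniformly random ℓ-element subset of {1,…,n}, independent of ω), one has: Γ·E_ω Σ_{t=0}^{ℓ−1} ‖∇f(x_t(ω))‖² ≤ [f(x_0) + c·(1/n)·Σ_{i=1}^n ‖x_0 − θ_i‖²] −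 E_{ω,Φ}[f(x_ℓ(ω)) + c'·(1/n)·Σ_{i=1}^n ‖x_ℓ(ω) − θ_i^{new}(ω,Φ)‖²]. -/
open Finset

/-- Resampling one coordinate of a uniformly distributed tuple preserves sums over all tuples. -/
theorem sum_sum_update_eq_card_nsmul {ι κ M : Type*} [Fintype ι] [DecidableEq ι] [Fintype κ]
    [AddCommMonoid M] (t : ι) (φ : (ι → κ) → M) :
    ∑ ω, ∑ k, φ (Function.update ω t k) = Fintype.card κ • ∑ ω, φ ω := by
  have h : ∑ p : (ι → κ) × κ, φ (Function.update p.1 t p.2) = ∑ p : (ι → κ) × κ, φ p.1 :=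
    Finset.sum_bij' (fun p _ => (Function.update p.1 t p.2, p.1 t))
      (fun p _ => (Function.update p.1 t p.2, p.1 t)) (by simp) (by simp) (by simp) (by simp)
      (by simp)
  rw [Fintype.sum_prod_type, Fintype.sum_prod_type] at h
  simp [h, Finset.smul_sum]

/-- A function with `L`-Lipschitz gradient is bounded above by a quadratic at every point. -/
theorem le_add_inner_add_mul_norm_sq {E : Type*} [NormedAddCommGroup E] [InnerProductSpace ℝ E]
    [CompleteSpace E] {f : E → ℝ} {g : E → E} {L : ℝ} (hL : 0 ≤ L)
    (hgrad : ∀ x, HasGradientAt f (g x) x) (hsmooth : ∀ x y, ‖g x - g y‖ ≤ L * ‖x - y‖)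
    (x y : E) : f y ≤ f x + inner ℝ (g x) (y - x) + L * ‖y - x‖ ^ 2 := by
  have h := (convex_segment x y).norm_image_sub_le_of_norm_hasFDerivWithin_le'
    (f := f) (f' := fun z => InnerProductSpace.toDual ℝ E (g z))
    (φ := InnerProductSpace.toDual ℝ E (g x)) (C := L * ‖y - x‖)
    (fun z _ => (hgrad z).hasFDerivAt.hasFDerivWithinAt)
    (fun z hz => by
      rw [← map_sub, LinearIsometryEquiv.norm_map]
      refine (hsmooth z x).trans (mul_le_mul_of_nonneg_left ?_ hL)
      obtain ⟨a, b, ha, hb, hab, rfl⟩ := hz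
      have : a • x + b • y - x = b • (y - x) := by
        rw [← sub_eq_iff_eq_add'.2 hab.symm]; module
      rw [this, norm_smul, Real.norm_of_nonneg hb]
      exact mul_le_of_le_one_left (norm_nonneg _) (by linarith))
    (left_mem_segment ℝ x y) (right_mem_segment ℝ x y)
  rw [InnerProductSpace.toDual_apply_apply] at h
  nlinarith [(abs_le.1 h).2]

/-- Variance bound: `m` is the mean of the `u i`. -/
theorem sum_norm_add_sq_le {E ι : Type*} [NormedAddCommGroup E] [InnerProductSpace ℝ E]
    (s : Finset ι) (u : ι → E) (a : E) (m : E) (hm : (#s : ℝ) • m = ∑ i ∈ s, u i) :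
    ∑ i ∈ s, ‖u i + a‖ ^ 2 ≤ #s * ‖m + a‖ ^ 2 + ∑ i ∈ s, ‖u i‖ ^ 2 := by
  have h : ∑ i ∈ s, inner ℝ (u i) a = #s * inner ℝ m a := by
    rw [← sum_inner, ← hm, real_inner_smul_left]
  simp only [norm_add_sq_real, sum_add_distrib, ← mul_sum, h, sum_const, nsmul_eq_mul]
  nlinarith [mul_nonneg (Nat.cast_nonneg (α := ℝ) #s) (sq_nonneg ‖m‖)]

theorem norm_sum_sq_le_card_mul_sum_norm_sq {E ι : Type*} [SeminormedAddCommGroup E]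
    (s : Finset ι) (u : ι → E) : ‖∑ i ∈ s, u i‖ ^ 2 ≤ #s * ∑ i ∈ s, ‖u i‖ ^ 2 :=
  (pow_le_pow_left₀ (norm_nonneg _) (norm_sum_le s u) 2).trans sq_sum_le_card_mul_sum_sq

/-- Displacement of gradient-type iterates between two times up to `l`. -/
theorem norm_sub_sq_le_of_step {E : Type*} [NormedAddCommGroup E] [NormedSpace ℝ E] {l : ℕ}
    {x v : ℕ → E} {η : ℝ} (hstep : ∀ t < l, x (t + 1) = x t - η • v t) {a b : ℕ} (hab : a ≤ b)
    (hb : b ≤ l) : ‖x b - x a‖ ^ 2 ≤ η ^ 2 * l * ∑ t ∈ range l, ‖v t‖ ^ 2 := by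
  have h : x b - x a = -(η • ∑ t ∈ Ico a b, v t) := by
    rw [← sum_Ico_sub x hab, smul_sum, ← sum_neg_distrib]
    refine sum_congr rfl fun t ht => ?_
    rw [hstep t ((mem_Ico.1 ht).2.trans_le hb)]
    abel
  rw [h, norm_neg, norm_smul, mul_pow, Real.norm_eq_abs, sq_abs, mul_assoc]
  refine mul_le_mul_of_nonneg_left
    ((norm_sum_sq_le_card_mul_sum_norm_sq _ _).trans ?_) (sq_nonneg η)
  gcongr
  · rw [Nat.card_Ico]; omega
  · intro t ht
    exact mem_range.2 ((mem_Ico.1 ht).2.trans_le hb)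

/-- A fixed index lies in a uniformly random `l`-subset of `Fin n` with probability `l / n`. -/
theorem sum_powersetCard_ite_mem {n l : ℕ} (hl : 0 < l) (i : Fin n) (a b : ℝ) :
    ∑ Φ ∈ powersetCard l (univ : Finset (Fin n)), (if i ∈ Φ then a else b)
      = n.choose l * ((l / n : ℝ) * a + (1 - l / n) * b) := by
  have hn : (n : ℝ) ≠ 0 := by have := i.pos; positivity
  have hcard : (#{Φ ∈ powersetCard l (univ : Finset (Fin n)) | i ∈ Φ} : ℝ)
      = n.choose l * (l / n) := by
    obtain ⟨m, rfl⟩ := Nat.exists_eq_add_of_lt i.pos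
    obtain ⟨k, rfl⟩ := Nat.exists_eq_add_of_lt hl
    have h := card_filter_powersetCard_subset {i} (univ : Finset (Fin (0 + m + 1))) (0 + k + 1)
      (subset_univ _) (by simp)
    simp only [singleton_subset_iff, card_univ, Fintype.card_fin, card_singleton,
      Nat.add_sub_cancel] at h
    have h' := congrArg (Nat.cast (R := ℝ)) (Nat.add_one_mul_choose_eq (0 + m) (0 + k))
    rw [h]
    field_simp
    push_cast at h' ⊢
    linarith
  have hcard' : (#{Φ ∈ powersetCard l (univ : Finset (Fin n)) | i ∉ Φ} : ℝ)
      = n.choose l * (1 - l / n) := by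
    have := card_filter_add_card_filter_not (s := powersetCard l (univ : Finset (Fin n)))
      (fun Φ => i ∈ Φ)
    rw [card_powersetCard, card_univ, Fintype.card_fin] at this
    have h := congrArg (Nat.cast (R := ℝ)) this
    push_cast at h
    linarith
  rw [sum_ite, sum_const, sum_const, nsmul_eq_mul, nsmul_eq_mul, hcard, hcard']
  ring

/-- If `A` does not depend on coordinate `t`, then that coordinate can be averaged independently. -/
theorem card_mul_sum_apply_eq_sum_sum {ι κ α : Type*} [Fintype ι] [DecidableEq ι] [Fintype κ]
    (t : ι) (A : (ι → κ) → α) (hA : ∀ ω k, A (Function.update ω t k) = A ω) (ψ : α → κ → ℝ) :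
    (Fintype.card κ : ℝ) * ∑ ω, ψ (A ω) (ω t) = ∑ ω, ∑ k, ψ (A ω) k := by
  rw [← nsmul_eq_mul, ← sum_sum_update_eq_card_nsmul t]
  simp [hA]

/-- Lemma 10: one-outer-loop Lyapunov decrease for non-convex `k`-SVRG-V2. -/
theorem kSVRG_nonconvex_lyapunov_decrease {E : Type*} [NormedAddCommGroup E]
    [InnerProductSpace ℝ E] [CompleteSpace E]
    (n l : ℕ) (hn : 0 < n) (hl : 0 < l) (hln : l ≤ n) (L : ℝ) (hL : 0 < L)
    (f : Fin n → E → ℝ) (g : Fin n → E → E)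
    (hgrad : ∀ i x, HasGradientAt (f i) (g i x) x)
    (hsmooth : ∀ i x y, ‖g i x - g i y‖ ≤ L * ‖x - y‖)
    (F : E → ℝ) (hF : ∀ x, F x = (1 / (n : ℝ)) * ∑ i, f i x)
    (G : E → E) (hG : ∀ x, G x = (1 / (n : ℝ)) • ∑ i, g i x)
    (θ : Fin n → E) (αbar : E) (hαbar : αbar = (1 / (n : ℝ)) • ∑ j, g j (θ j))
    (η : ℝ) (hη : 0 < η) (γ : ℝ) (hγ : 0 < γ)
    (hsmall : 2 * L ^ 2 * η ^ 2 * (l : ℝ) ^ 2 < 1)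
    (b1 : ℝ) (hb1 : b1 = 1 / (1 - 2 * L ^ 2 * η ^ 2 * (l : ℝ) ^ 2))
    (c' : ℝ) (hc' : 0 ≤ c') (c Γ : ℝ)
    (hc : c = c' * (1 - (l : ℝ) / (n : ℝ) + γ * η * (l : ℝ)
        + 4 * b1 * η ^ 2 * L ^ 2 * (l : ℝ) ^ 2) + 2 * b1 * η ^ 2 * L ^ 3 * (l : ℝ))
    (hΓ : Γ = η - c' * η / γ - b1 * η ^ 2 * L - 2 * b1 * c' * η ^ 2 * (l : ℝ))
    (x0 : E)
    (X V : (Fin l → Fin n) → ℕ → E)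
    (hX0 : ∀ ω, X ω 0 = x0)
    (hV : ∀ ω (t : Fin l),
      V ω t.val = g (ω t) (X ω t.val) - g (ω t) (θ (ω t)) + αbar)
    (hXstep : ∀ ω (t : Fin l), X ω (t.val + 1) = X ω t.val - η • V ω t.val)
    (xt : (Fin l → Fin n) → E)
    (hxt : ∀ ω, xt ω = (1 / (l : ℝ)) • ∑ t ∈ Finset.range l, X ω t) :
    Γ * ((1 / (n : ℝ) ^ l) *
        ∑ ω : Fin l → Fin n, ∑ t ∈ Finset.range l, ‖G (X ω t)‖ ^ 2) ≤
      (F x0 + c * ((1 / (n : ℝ)) * ∑ i, ‖x0 - θ i‖ ^ 2))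
        - (1 / ((n : ℝ) ^ l * (n.choose l : ℝ))) *
            ∑ ω : Fin l → Fin n,
              ∑ Φ ∈ Finset.powersetCard l (Finset.univ : Finset (Fin n)),
                (F (X ω l) + c' * ((1 / (n : ℝ)) * ∑ i,
                  ‖X ω l - (if i ∈ Φ then xt ω else θ i)‖ ^ 2)) := by
  have hn' : (0 : ℝ) < n := by exact_mod_cast hn
  have hl' : (0 : ℝ) < l := by exact_mod_cast hl
  have hGn (x : E) : (n : ℝ) • G x = ∑ i, g i x := by
    rw [hG, smul_smul, mul_one_div_cancel hn'.ne', one_smul]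
  have hαn : (n : ℝ) • αbar = ∑ i, g i (θ i) := by
    rw [hαbar, smul_smul, mul_one_div_cancel hn'.ne', one_smul]
  have hFgrad (x : E) : HasGradientAt F (G x) x := by
    rw [hasGradientAt_iff_hasFDerivAt, hG, map_smul, map_sum]
    rw [show F = fun x => (1 / (n : ℝ)) * ∑ i, f i x from funext hF]
    exact (HasFDerivAt.fun_sum fun i _ => (hgrad i x).hasFDerivAt).const_mul _
  have hGsmooth (x y : E) : ‖G x - G y‖ ≤ L * ‖x - y‖ := by
    rw [hG, hG, ← smul_sub, ← sum_sub_distrib, norm_smul, Real.norm_of_nonneg (by positivity)]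
    have h : ‖∑ i, (g i x - g i y)‖ ≤ n * (L * ‖x - y‖) :=
      (norm_sum_le_of_le _ fun i _ => hsmooth i x y).trans (by simp)
    rw [one_div, inv_mul_le_iff₀ hn']
    exact h
  have hstep (ω : Fin l → Fin n) : ∀ t < l, X ω (t + 1) = X ω t - η • V ω t :=
    fun t ht => hXstep ω ⟨t, ht⟩
  have hXupd (ω : Fin l → Fin n) (t : Fin l) (k : Fin n) :
      ∀ s ≤ t.val, X (Function.update ω t k) s = X ω s := by
    intro s
    induction s with
    | zero => simp [hX0]
    | succ s ih =>
      intro hs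
      have hsl : s < l := by omega
      have hne : (⟨s, hsl⟩ : Fin l) ≠ t := by
        rintro rfl
        simp at hs
      have h₁ := hV (Function.update ω t k) ⟨s, hsl⟩
      have h₂ := hV ω ⟨s, hsl⟩
      rw [Function.update_of_ne hne] at h₁
      simp only [ih (by omega)] at h₁ h₂
      rw [hstep _ s hsl, hstep _ s hsl, h₁, h₂, ih (by omega)]
  have hcond (t : ℕ) (ht : t < l) (ψ : E → E → ℝ) :
      (n : ℝ) * ∑ ω, ψ (X ω t) (V ω t)
        = ∑ ω, ∑ i, ψ (X ω t) (g i (X ω t) - g i (θ i) + αbar) := by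
    have h := card_mul_sum_apply_eq_sum_sum (⟨t, ht⟩ : Fin l) (fun ω => X ω t)
      (fun ω k => hXupd ω ⟨t, ht⟩ k t le_rfl)
      (fun x i => ψ x (g i x - g i (θ i) + αbar))
    rw [Fintype.card_fin] at h
    rw [← h]
    exact congrArg _ (sum_congr rfl fun ω _ => congrArg _ (hV ω ⟨t, ht⟩))
  have hmean (x a : E) : ∑ i, inner ℝ a (g i x - g i (θ i) + αbar) = n * inner ℝ a (G x) := by
    rw [← inner_sum, sum_add_distrib, sum_sub_distrib, ← hGn, ← hαn]
    simp [← Nat.cast_smul_eq_nsmul ℝ, real_inner_smul_right]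
  have hvar (x : E) : ∑ i, ‖g i x - g i (θ i) + αbar‖ ^ 2
      ≤ n * ‖G x‖ ^ 2 + L ^ 2 * ∑ i, ‖x - θ i‖ ^ 2 := by
    have h := sum_norm_add_sq_le univ (fun i => g i x - g i (θ i)) αbar (G x - αbar)
      (by rw [card_univ, Fintype.card_fin, smul_sub, hGn, hαn, sum_sub_distrib])
    rw [sub_add_cancel, card_univ, Fintype.card_fin] at h
    refine h.trans (add_le_add_right ?_ _)
    rw [mul_sum]
    refine sum_le_sum fun i _ => ?_
    rw [← mul_pow]
    exact pow_le_pow_left₀ (norm_nonneg _) (hsmooth i _ _) 2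
  set N : ℝ := (n : ℝ) ^ l with hN
  have hNpos : 0 < N := by positivity
  have hsum_const (a : ℝ) : ∑ _ω : Fin l → Fin n, a = N * a := by simp [hN]
  set D : ℝ := (1 / (n : ℝ)) * ∑ i, ‖x0 - θ i‖ ^ 2 with hD
  have hDn : ∑ i, ‖x0 - θ i‖ ^ 2 = n * D := by rw [hD]; field_simp
  have hD0 : 0 ≤ D := by positivity
  set SG : ℝ := ∑ ω : Fin l → Fin n, ∑ t ∈ Finset.range l, ‖G (X ω t)‖ ^ 2 with hSG
  set SV : ℝ := ∑ ω : Fin l → Fin n, ∑ t ∈ Finset.range l, ‖V ω t‖ ^ 2 with hSV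
  have hSG0 : 0 ≤ SG := by positivity
  have hdist (ω : Fin l → Fin n) {a b : ℕ} (hab : a ≤ b) (hb : b ≤ l) :=
    norm_sub_sq_le_of_step (hstep ω) hab hb
  have hdist0 (ω : Fin l → Fin n) {t : ℕ} (ht : t ≤ l) :
      ‖X ω t - x0‖ ^ 2 ≤ η ^ 2 * l * ∑ s ∈ range l, ‖V ω s‖ ^ 2 := by
    simpa only [hX0] using hdist ω (Nat.zero_le t) ht
  have hSV_le : SV ≤ b1 * (SG + 2 * L ^ 2 * l * (N * D)) := by
    have hθ (ω : Fin l → Fin n) (t : ℕ) (ht : t < l) : ∑ i, ‖X ω t - θ i‖ ^ 2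
        ≤ n * (2 * (η ^ 2 * l * ∑ s ∈ range l, ‖V ω s‖ ^ 2) + 2 * D) := by
      have h (i : Fin n) : ‖X ω t - θ i‖ ^ 2
          ≤ 2 * (η ^ 2 * l * ∑ s ∈ range l, ‖V ω s‖ ^ 2) + 2 * ‖x0 - θ i‖ ^ 2 := by
        have h₁ := hdist0 ω ht.le
        have h₂ := parallelogram_law_with_norm ℝ (X ω t - x0) (x0 - θ i)
        rw [sub_add_sub_cancel] at h₂
        nlinarith [sq_nonneg ‖X ω t - x0 - (x0 - θ i)‖]
      refine (sum_le_sum fun i _ => h i).trans_eq ?_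
      rw [sum_add_distrib, ← mul_sum univ (fun i => ‖x0 - θ i‖ ^ 2), hDn]
      simp
      ring
    have hstepV (t : ℕ) (ht : t ∈ range l) : ∑ ω, ‖V ω t‖ ^ 2
        ≤ ∑ ω, ‖G (X ω t)‖ ^ 2 + L ^ 2 * (2 * (η ^ 2 * l * SV) + 2 * (N * D)) := by
      rw [mem_range] at ht
      refine le_of_mul_le_mul_left ?_ hn'
      rw [hcond t ht fun _ v => ‖v‖ ^ 2]
      refine (sum_le_sum fun ω _ => (hvar (X ω t)).trans (add_le_add_right
        (mul_le_mul_of_nonneg_left (hθ ω t ht) (sq_nonneg L)) _)).trans_eq ?_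
      simp only [sum_add_distrib, ← mul_sum, hsum_const, ← hSV]
      ring
    have h := sum_le_sum hstepV
    rw [sum_add_distrib, sum_comm, ← hSV, sum_comm, ← hSG, sum_const, card_range,
      nsmul_eq_mul] at h
    rw [hb1, one_div, ← div_eq_inv_mul, le_div_iff₀ (by linarith)]
    linarith
  have hinner (t : ℕ) (ht : t < l) (a : E → E) :
      ∑ ω, inner ℝ (a (X ω t)) (V ω t) = ∑ ω, inner ℝ (a (X ω t)) (G (X ω t)) := by
    refine mul_left_cancel₀ hn'.ne' ?_
    rw [hcond t ht fun x v => inner ℝ (a x) v]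
    simp only [hmean, mul_sum]
  have hFl : ∑ ω, F (X ω l) ≤ N * F x0 - η * SG + L * η ^ 2 * SV := by
    have h (t : ℕ) (ht : t ∈ range l) : ∑ ω, (F (X ω (t + 1)) - F (X ω t))
        ≤ L * η ^ 2 * ∑ ω, ‖V ω t‖ ^ 2 - η * ∑ ω, ‖G (X ω t)‖ ^ 2 := by
      rw [mem_range] at ht
      have hdescent (ω : Fin l → Fin n) : F (X ω (t + 1)) - F (X ω t)
          ≤ L * η ^ 2 * ‖V ω t‖ ^ 2 - η * inner ℝ (G (X ω t)) (V ω t) := by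
        have h := le_add_inner_add_mul_norm_sq hL.le hFgrad hGsmooth (X ω t) (X ω (t + 1))
        rw [hstep ω t ht, sub_sub_cancel_left, inner_neg_right, real_inner_smul_right, norm_neg,
          norm_smul, mul_pow, Real.norm_eq_abs, sq_abs] at h
        rw [hstep ω t ht]
        linarith
      refine (sum_le_sum fun ω _ => hdescent ω).trans_eq ?_
      rw [sum_sub_distrib, ← mul_sum, ← mul_sum, hinner t ht G]
      simp only [real_inner_self_eq_norm_sq]
    have h := sum_le_sum h
    have htel (ω : Fin l → Fin n) :
        ∑ t ∈ range l, (F (X ω (t + 1)) - F (X ω t)) = F (X ω l) - F x0 := by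
      rw [sum_range_sub fun t => F (X ω t), hX0]
    rw [sum_comm, sum_congr rfl fun ω _ => htel ω, sum_sub_distrib, sum_sub_distrib, hsum_const,
      ← mul_sum, ← mul_sum, sum_comm, ← hSV, sum_comm, ← hSG] at h
    linarith
  have hθl (i : Fin n) : ∑ ω, ‖X ω l - θ i‖ ^ 2
      ≤ η ^ 2 * l * SV + η / γ * SG + (1 + γ * η * l) * (N * ‖x0 - θ i‖ ^ 2) := by
    have hyoung (y : E) : -(2 * inner ℝ (x0 - θ i) y) ≤ ‖y‖ ^ 2 / γ + γ * ‖x0 - θ i‖ ^ 2 := by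
      have h := norm_add_sq_real (γ • (x0 - θ i)) y
      rw [real_inner_smul_left, norm_smul, mul_pow, Real.norm_eq_abs, sq_abs] at h
      rw [← sub_nonneg]
      have h' : ‖y‖ ^ 2 / γ + γ * ‖x0 - θ i‖ ^ 2 - -(2 * inner ℝ (x0 - θ i) y)
          = ‖γ • (x0 - θ i) + y‖ ^ 2 / γ := by
        rw [h]
        field_simp
        ring
      rw [h']
      positivity
    have hsub (ω : Fin l → Fin n) : X ω l - x0 = ∑ t ∈ range l, -(η • V ω t) := by
      rw [← hX0 ω, ← sum_range_sub]
      refine sum_congr rfl fun t ht => ?_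
      rw [hstep ω t (mem_range.1 ht), sub_sub_cancel_left]
    have hcross : ∑ ω, 2 * inner ℝ (x0 - θ i) (X ω l - x0)
        ≤ η / γ * SG + γ * η * l * (N * ‖x0 - θ i‖ ^ 2) := by
      have h (t : ℕ) (ht : t ∈ range l) : ∑ ω, -(2 * inner ℝ (x0 - θ i) (V ω t))
          ≤ ∑ ω, (‖G (X ω t)‖ ^ 2 / γ + γ * ‖x0 - θ i‖ ^ 2) := by
        rw [sum_neg_distrib, ← mul_sum, hinner t (mem_range.1 ht) fun _ => x0 - θ i, mul_sum,
          ← sum_neg_distrib]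
        exact sum_le_sum fun ω _ => hyoung _
      have h := mul_le_mul_of_nonneg_left (sum_le_sum h) hη.le
      simp only [sum_add_distrib, hsum_const, ← sum_div, sum_const, card_range, nsmul_eq_mul] at h
      rw [sum_comm, sum_comm (s := range l) (t := univ), ← hSG] at h
      refine le_of_eq_of_le ?_ (h.trans_eq (by ring))
      simp only [hsub, inner_sum, inner_neg_right, real_inner_smul_right, mul_sum]
      exact sum_congr rfl fun ω _ => sum_congr rfl fun t _ => by ring
    have hexpand (ω : Fin l → Fin n) : ‖X ω l - θ i‖ ^ 2
        = ‖X ω l - x0‖ ^ 2 + 2 * inner ℝ (x0 - θ i) (X ω l - x0) + ‖x0 - θ i‖ ^ 2 := by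
      rw [← sub_add_sub_cancel (X ω l) x0 (θ i), norm_add_sq_real, real_inner_comm]
    have h₀ : ∑ ω, ‖X ω l - x0‖ ^ 2 ≤ η ^ 2 * l * SV := by
      rw [hSV, mul_sum]
      exact sum_le_sum fun ω _ => hdist0 ω le_rfl
    simp only [hexpand, sum_add_distrib, hsum_const]
    linarith
  have hxtl : ∑ ω, ‖X ω l - xt ω‖ ^ 2 ≤ η ^ 2 * l * SV := by
    rw [hSV, mul_sum]
    refine sum_le_sum fun ω _ => ?_
    have h : X ω l - xt ω = (1 / (l : ℝ)) • ∑ t ∈ range l, (X ω l - X ω t) := by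
      rw [hxt, sum_sub_distrib, smul_sub, sum_const, card_range, ← Nat.cast_smul_eq_nsmul ℝ,
        smul_smul, one_div_mul_cancel hl'.ne', one_smul]
    have h₁ := norm_sum_sq_le_card_mul_sum_norm_sq (range l) fun t => X ω l - X ω t
    have h₂ := sum_le_card_nsmul (range l) (fun t => ‖X ω l - X ω t‖ ^ 2) _
      fun t ht => hdist ω (mem_range.1 ht).le le_rfl
    rw [card_range] at h₁ h₂
    rw [nsmul_eq_mul] at h₂
    rw [h, norm_smul, mul_pow, Real.norm_of_nonneg (by positivity), one_div, inv_pow,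
      inv_mul_le_iff₀ (by positivity), sq (l : ℝ), mul_assoc]
    exact h₁.trans (mul_le_mul_of_nonneg_left h₂ hl'.le)
  have hθavg : (1 / (n : ℝ)) * ∑ i, ∑ ω, ‖X ω l - θ i‖ ^ 2
      ≤ η ^ 2 * l * SV + η / γ * SG + (1 + γ * η * l) * (N * D) := by
    rw [one_div, inv_mul_le_iff₀ hn']
    refine (sum_le_sum fun i _ => hθl i).trans_eq ?_
    simp only [sum_add_distrib, ← mul_sum, hDn, sum_const, card_univ, Fintype.card_fin,
      nsmul_eq_mul]
    ring
  have hC : (0 : ℝ) < n.choose l := by exact_mod_cast Nat.choose_pos hln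
  have hΦ (ω : Fin l → Fin n) :
      ∑ Φ ∈ powersetCard l (univ : Finset (Fin n)), (F (X ω l) + c' * ((1 / (n : ℝ)) * ∑ i,
        ‖X ω l - (if i ∈ Φ then xt ω else θ i)‖ ^ 2))
      = n.choose l * (F (X ω l) + c' * ((l / n : ℝ) * ‖X ω l - xt ω‖ ^ 2
        + (1 - l / n) * ((1 / (n : ℝ)) * ∑ i, ‖X ω l - θ i‖ ^ 2))) := by
    have h (i : Fin n) (Φ : Finset (Fin n)) : ‖X ω l - (if i ∈ Φ then xt ω else θ i)‖ ^ 2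
        = if i ∈ Φ then ‖X ω l - xt ω‖ ^ 2 else ‖X ω l - θ i‖ ^ 2 := by split_ifs <;> rfl
    rw [sum_add_distrib, ← mul_sum, ← mul_sum, sum_comm]
    simp only [h, sum_powersetCard_ite_mem hl, ← mul_sum, sum_add_distrib, sum_const,
      card_powersetCard, card_univ, Fintype.card_fin, nsmul_eq_mul]
    field_simp
  have htotal : (1 / (N * n.choose l)) * ∑ ω : Fin l → Fin n,
      ∑ Φ ∈ powersetCard l (univ : Finset (Fin n)), (F (X ω l) + c' * ((1 / (n : ℝ)) * ∑ i,
        ‖X ω l - (if i ∈ Φ then xt ω else θ i)‖ ^ 2))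
      = (1 / N) * (∑ ω, F (X ω l) + c' * ((l / n : ℝ) * ∑ ω, ‖X ω l - xt ω‖ ^ 2
        + (1 - l / n) * ((1 / (n : ℝ)) * ∑ i, ∑ ω, ‖X ω l - θ i‖ ^ 2))) := by
    simp only [hΦ, ← mul_sum, sum_add_distrib]
    rw [sum_comm (s := (univ : Finset (Fin n)))]
    field_simp
  rw [htotal]
  have hp0 : (0 : ℝ) ≤ l / n := by positivity
  have hp1 : (0 : ℝ) ≤ 1 - l / n := by
    rw [sub_nonneg, div_le_one hn']
    exact_mod_cast hln
  set p : ℝ := (l : ℝ) / n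
  have hb1pos : 0 < b1 := by
    rw [hb1]
    exact one_div_pos.2 (by linarith)
  have hND : 0 ≤ N * D := by positivity
  have hmix : p * ∑ ω, ‖X ω l - xt ω‖ ^ 2
      + (1 - p) * ((1 / (n : ℝ)) * ∑ i, ∑ ω, ‖X ω l - θ i‖ ^ 2)
      ≤ η ^ 2 * l * SV + η / γ * SG + (1 - p + γ * η * l) * (N * D) := by
    have h₁ := mul_le_mul_of_nonneg_left hxtl hp0
    have h₂ := mul_le_mul_of_nonneg_left hθavg hp1
    have h₃ : 0 ≤ p * (η / γ * SG + γ * η * l * (N * D)) := by positivity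
    linarith
  have hkey : Γ * SG ≤ N * F x0 + c * (N * D) - (∑ ω, F (X ω l)
      + c' * (p * ∑ ω, ‖X ω l - xt ω‖ ^ 2
        + (1 - p) * ((1 / (n : ℝ)) * ∑ i, ∑ ω, ‖X ω l - θ i‖ ^ 2))) := by
    have h₁ := mul_le_mul_of_nonneg_left hmix hc'
    have h₂ := mul_le_mul_of_nonneg_left hSV_le
      (show 0 ≤ L * η ^ 2 + c' * (η ^ 2 * l) by positivity)
    have h₃ : 0 ≤ c' * b1 * η ^ 2 * l * SG := by positivity
    have h₄ : 0 ≤ c' * b1 * η ^ 2 * L ^ 2 * l ^ 2 * (N * D) := by positivity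
    rw [hc, hΓ]
    have h₅ : c' * η / γ * SG = c' * (η / γ * SG) := by ring
    linarith
  have h := mul_le_mul_of_nonneg_left hkey (one_div_pos.2 hNpos).le
  refine le_of_eq_of_le (by ring) (h.trans_eq ?_)
  field_simp
end
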